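/- arXiv:1305.0628 — 9 statements merged into one kernel-verified Lean document; each statement's English description precedes it below -/
import Mathlib

section
/- Let $0 < k < 1$ and $t \in [0,k]$. Then $\max\{(k-t)/(k(1-kt)),\; t/k\} \le \min\{(k+t)/(k(1+kt)),\; (2k-(1+k^2)t)/(k(1+k^2-2kt))\}$; moreover all four denominators are positive, in particular $1+k^2-2kt \ge (1-k)^2 > 0$. -/
/-- The corridor (5.6) of Hu–Shen is nonempty: the lower bound is at most the upper
bound, and all denominators involved are positive. -/
theorem corridor_nonempty (k t : ℝ) (hk0 : 0 < k) (hk1 : k < 1) (ht : t ∈ Set.Icc 0 k) :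
    max ((k - t) / (k * (1 - k * t))) (t / k) ≤
      min ((k + t) / (k * (1 + k * t)))
        ((2 * k - (1 + k ^ 2) * t) / (k * (1 + k ^ 2 - 2 * k * t))) ∧
    0 < k * (1 - k * t) ∧ 0 < k ∧ 0 < k * (1 + k * t) ∧
    0 < k * (1 + k ^ 2 - 2 * k * t) ∧
    (1 - k) ^ 2 ≤ 1 + k ^ 2 - 2 * k * t ∧ 0 < (1 - k) ^ 2 := by
  obtain ⟨h0, h1⟩ := ht
  have ht1 : t < 1 := lt_of_le_of_lt h1 hk1
  have hkt : k * t < 1 := by nlinarith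
  have hkt0 : 0 ≤ k * t := by positivity
  have e : (1 - k) ^ 2 ≤ 1 + k ^ 2 - 2 * k * t := by nlinarith
  have f : 0 < (1 - k) ^ 2 := pow_pos (by linarith) 2
  have a : 0 < k * (1 - k * t) := mul_pos hk0 (by linarith)
  have b : 0 < k * (1 + k * t) := mul_pos hk0 (by linarith)
  have c : 0 < k * (1 + k ^ 2 - 2 * k * t) := mul_pos hk0 (by linarith)
  have hk2 : 0 ≤ 1 - k ^ 2 := by nlinarith
  have ht2 : 0 ≤ 1 - t ^ 2 := by nlinarith
  refine ⟨max_le (le_min ?_ ?_) (le_min ?_ ?_), a, hk0, b, c, e, f⟩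
  · rw [div_le_div_iff₀ a b]
    have := mul_nonneg hk0.le (mul_nonneg h0 hk2)
    linarith
  · rw [div_le_div_iff₀ a c]
    have := mul_nonneg (mul_nonneg hk0.le hk0.le) (mul_nonneg hk2 ht2)
    linarith
  · rw [div_le_div_iff₀ hk0 b]
    have := mul_nonneg (mul_nonneg hk0.le hk0.le) ht2
    linarith
  · rw [div_le_div_iff₀ hk0 c]
    have := mul_nonneg hk0.le (mul_nonneg (sub_nonneg.2 h1) (sub_nonneg.2 hkt.le))
    linarith
end

section
/- Let $0 < k < 1$, $t \in [0,k]$, and let $\sigma$ be a real number with $\max\{(k-t)/(k(1-kt)),\; t/k\} \le \sigma \le \min\{(k+t)/(k(1+kt)),\; (2k-(1+k^2)t)/(k(1+k^2-2kt))\}$. Then $k|\sigma-1|/(1-k^2\sigma) \le (k-t)/(1-kt)$; equivalently, $\max\{k|\sigma-1|/(1-k^2\sigma),\; (k-t)/(1-kt)\} = (k-t)/(1-kt)$. -/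
/-- The corridor condition (5.6) of Hu–Shen at `(k, t)`. -/
def corridor (k t σ : ℝ) : Prop :=
  max ((k - t) / (k * (1 - k * t))) (t / k) ≤ σ ∧
  σ ≤ min ((k + t) / (k * (1 + k * t)))
        ((2 * k - (1 + k ^ 2) * t) / (k * (1 + k ^ 2 - 2 * k * t)))

/-- If `σ` satisfies the corridor condition (5.6) at `(k, t)`, then
`k|σ-1|/(1-k²σ) ≤ (k-t)/(1-kt)`; equivalently the max of the two is `(k-t)/(1-kt)`. -/
theorem sup_norm_eq (k t σ : ℝ) (hk0 : 0 < k) (hk1 : k < 1) (ht : t ∈ Set.Icc 0 k)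
    (hσ : corridor k t σ) :
    k * |σ - 1| / (1 - k ^ 2 * σ) ≤ (k - t) / (1 - k * t) ∧
    max (k * |σ - 1| / (1 - k ^ 2 * σ)) ((k - t) / (1 - k * t)) = (k - t) / (1 - k * t) := by
  obtain ⟨ht0, htk⟩ := ht
  obtain ⟨hl, hu⟩ := hσ
  have h2 := (le_max_right _ _).trans hl
  have h3 := hu.trans (min_le_left _ _)
  have h4 := hu.trans (min_le_right _ _)
  have hkt : 0 ≤ k * t := mul_nonneg hk0.le ht0
  have hkt' : k * t ≤ k * k := mul_le_mul_of_nonneg_left htk hk0.le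
  have hkk : k * k < 1 := by nlinarith
  have hd : 0 < 1 + k ^ 2 - 2 * k * t := by nlinarith
  rw [div_le_iff₀ hk0] at h2
  rw [le_div_iff₀ (by positivity)] at h3
  rw [le_div_iff₀ (by positivity)] at h4
  have hden : 0 < 1 - k ^ 2 * σ := by
    have h5 := mul_le_mul_of_nonneg_left h3 hk0.le
    by_contra hc
    push Not at hc
    have h6 := mul_le_mul_of_nonneg_right hc (by linarith : 0 ≤ 1 + k * t)
    nlinarith
  have main : k * |σ - 1| / (1 - k ^ 2 * σ) ≤ (k - t) / (1 - k * t) := by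
    rw [div_le_div_iff₀ hden (by linarith)]
    rcases abs_cases (σ - 1) with ⟨h, _⟩ | ⟨h, _⟩
    · rw [h]
      linarith
    · rw [h]
      have := mul_le_mul_of_nonneg_right h2 (by nlinarith : 0 ≤ 1 - k * k)
      linarith
  exact ⟨main, max_eq_right main⟩
end

section
/- Let $0 < k < 1$ and let $\sigma : [0,k] \to \mathbb{R}$ satisfy, for every $t \in [0,k]$, $\max\{(k-t)/(k(1-kt)),\; t/k\} \le \sigma(t) \le \min\{(k+t)/(k(1+kt)),\; (2k-(1+k^2)t)/(k(1+k^2-2kt))\}$. Then: (a) $\sigma(0) = 1$ and $\sigma(k) = 1$; (b) if the right derivative $\sigma'(0) = \lim_{t\to 0^+} (\sigma(t)-1)/t$ exists, then $|\sigma'(0)| \le (1-k^2)/k$; (c) if the left derivative $\sigma'(k) = \lim_{t\to k^-} (\sigma(t)-1)/(t-k)$ exists, then $|\sigma'(k)| \le 1/k$. -/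
open Filter Topology

theorem corridor_derivative_bounds (k : ℝ) (hk0 : 0 < k) (hk1 : k < 1) (σ : ℝ → ℝ)
    (hσ : ∀ t ∈ Set.Icc (0:ℝ) k, corridor k t (σ t)) :
    (σ 0 = 1 ∧ σ k = 1) ∧
    (∀ δ : ℝ, Tendsto (fun t => (σ t - 1) / t) (𝓝[>] (0:ℝ)) (𝓝 δ) →
      |δ| ≤ (1 - k ^ 2) / k) ∧
    (∀ η : ℝ, Tendsto (fun t => (σ t - 1) / (t - k)) (𝓝[<] k) (𝓝 η) →
      |η| ≤ 1 / k) := by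
  have hk2 : 0 < 1 - k ^ 2 := by nlinarith
  have hkne : k ≠ 0 := hk0.ne'
  have H : ∀ t ∈ Set.Icc (0:ℝ) k,
      -(t * ((1 - k ^ 2) / (k * (1 - k * t)))) ≤ σ t - 1 ∧ (t - k) / k ≤ σ t - 1 ∧
      σ t - 1 ≤ t * ((1 - k ^ 2) / (k * (1 + k * t))) ∧
      σ t - 1 ≤ (k - t) * ((1 - k ^ 2) / (k * (1 + k ^ 2 - 2 * k * t))) := by
    intro t ht
    obtain ⟨h1, h2⟩ := hσ t ht
    obtain ⟨t0, tk⟩ := ht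
    obtain ⟨a, b⟩ := max_le_iff.1 h1
    obtain ⟨c, d⟩ := le_min_iff.1 h2
    have n1 : 1 - k * t ≠ 0 := by nlinarith
    have n2 : 1 + k * t ≠ 0 := by positivity
    have n3 : 1 + k ^ 2 - 2 * k * t ≠ 0 := by nlinarith
    have e1 : (k - t) / (k * (1 - k * t)) = 1 - (t * ((1 - k ^ 2) / (k * (1 - k * t)))) := by
      field_simp; ring
    have e2 : t / k = 1 + (t - k) / k := by field_simp; ring
    have e3 : (k + t) / (k * (1 + k * t)) = 1 + t * ((1 - k ^ 2) / (k * (1 + k * t))) := by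
      field_simp; ring
    have e4 : (2 * k - (1 + k ^ 2) * t) / (k * (1 + k ^ 2 - 2 * k * t))
        = 1 + (k - t) * ((1 - k ^ 2) / (k * (1 + k ^ 2 - 2 * k * t))) := by
      field_simp; ring
    rw [e1] at a; rw [e2] at b; rw [e3] at c; rw [e4] at d
    refine ⟨?_, ?_, ?_, ?_⟩ <;> linarith
  refine ⟨⟨?_, ?_⟩, ?_, ?_⟩
  · obtain ⟨a, b, c, d⟩ := H 0 ⟨le_rfl, hk0.le⟩
    simp only [zero_mul] at a c
    linarith
  · obtain ⟨a, b, c, d⟩ := H k ⟨hk0.le, le_rfl⟩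
    simp only [sub_self, zero_mul, zero_div] at b d
    linarith
  · intro δ hδ
    have hev : ∀ᶠ t in 𝓝[>] (0:ℝ), t ∈ Set.Ioo 0 k := Ioo_mem_nhdsGT hk0
    have L : Tendsto (fun t => -((1 - k ^ 2) / (k * (1 - k * t)))) (𝓝[>] (0:ℝ))
        (𝓝 (-((1 - k ^ 2) / k))) := by
      have : ContinuousAt (fun t => -((1 - k ^ 2) / (k * (1 - k * t)))) 0 := by
        fun_prop (disch := simpa using hkne)
      have h := this.tendsto.mono_left (nhdsWithin_le_nhds (s := Set.Ioi 0))
      simpa using h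
    have U : Tendsto (fun t => ((1 - k ^ 2) / (k * (1 + k * t)))) (𝓝[>] (0:ℝ))
        (𝓝 ((1 - k ^ 2) / k)) := by
      have : ContinuousAt (fun t => ((1 - k ^ 2) / (k * (1 + k * t)))) 0 := by
        fun_prop (disch := simpa using hkne)
      have h := this.tendsto.mono_left (nhdsWithin_le_nhds (s := Set.Ioi 0))
      simpa using h
    refine abs_le.2 ⟨le_of_tendsto_of_tendsto L hδ ?_, le_of_tendsto_of_tendsto hδ U ?_⟩
    · filter_upwards [hev] with t ht
      obtain ⟨a, b, c, d⟩ := H t ⟨ht.1.le, ht.2.le⟩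
      rw [le_div_iff₀ ht.1]; linarith
    · filter_upwards [hev] with t ht
      obtain ⟨a, b, c, d⟩ := H t ⟨ht.1.le, ht.2.le⟩
      rw [div_le_iff₀ ht.1]; linarith
  · intro η hη
    have hev : ∀ᶠ t in 𝓝[<] k, t ∈ Set.Ioo 0 k := Ioo_mem_nhdsLT hk0
    have L : Tendsto (fun t => -((1 - k ^ 2) / (k * (1 + k ^ 2 - 2 * k * t)))) (𝓝[<] k)
        (𝓝 (-(1 / k))) := by
      have n : k * (1 + k ^ 2 - 2 * k * k) ≠ 0 := mul_ne_zero hkne (by nlinarith)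
      have : ContinuousAt (fun t => -((1 - k ^ 2) / (k * (1 + k ^ 2 - 2 * k * t)))) k := by
        fun_prop (disch := exact n)
      have h := this.tendsto.mono_left (nhdsWithin_le_nhds (s := Set.Iio k))
      have e : (1 - k ^ 2) / (k * (1 + k ^ 2 - 2 * k * k)) = 1 / k := by
        rw [div_eq_div_iff n hkne]; ring
      rwa [e] at h
    refine abs_le.2 ⟨le_of_tendsto_of_tendsto L hη ?_, le_of_tendsto hη ?_⟩
    · filter_upwards [hev] with t ht
      obtain ⟨a, b, c, d⟩ := H t ⟨ht.1.le, ht.2.le⟩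
      rw [le_div_iff_of_neg (sub_neg.2 ht.2)]; linarith
    · filter_upwards [hev] with t ht
      obtain ⟨a, b, c, d⟩ := H t ⟨ht.1.le, ht.2.le⟩
      rw [div_le_iff_of_neg (sub_neg.2 ht.2)]
      rw [one_div_mul_eq_div]; exact b
end

section
/- Let $0 < k < 1$ and let $\sigma : [0,k] \to \mathbb{R}$ satisfy, for every $t \in [0,k]$, $\max\{(k-t)/(k(1-kt)),\; t/k\} \le \sigma(t) \le \min\{(k+t)/(k(1+kt)),\; (2k-(1+k^2)t)/(k(1+k^2-2kt))\}$. Set $v(t) = (k-t)/(1-kt)$ and $K(t) = (k\sigma(t) - v(t))/(1 - k\sigma(t)\,v(t))$. Then $0 \le K(t) < 1$ for all $t \in [0,k]$, and as $t \to 0^+$ one has $\operatorname{artanh}(K(t)) = \frac{k(\sigma(t)-1)}{1-k^2} + t + o(t)$; that is, $\lim_{t\to 0^+}\big(\operatorname{artanh}(K(t)) - k(\sigma(t)-1)/(1-k^2) - t\big)/t = 0$. -/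
open Filter Topology

/-- `artanh x = (1/2) log ((1+x)/(1-x))`. -/
noncomputable def arctanh (x : ℝ) : ℝ := Real.log ((1 + x) / (1 - x)) / 2

/-- `v(t) = (k-t)/(1-kt)`. -/
noncomputable def v (k t : ℝ) : ℝ := (k - t) / (1 - k * t)

/-- `K(t) = (kσ(t) - v(t))/(1 - kσ(t)v(t))`, the extremal dilatation (5.18). -/
noncomputable def Kdil (k : ℝ) (σ : ℝ → ℝ) (t : ℝ) : ℝ :=
  (k * σ t - v k t) / (1 - k * σ t * v k t)

lemma hasDerivAt_arctanh_aux {x : ℝ} (h0 : -1 < x) (h1 : x < 1) :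
    HasDerivAt arctanh (1 / (1 - x ^ 2)) x := by
  have ha : (1 - x) ≠ 0 := by linarith
  have hb : (1 + x) ≠ 0 := by linarith
  have h := ((((hasDerivAt_id x).const_add 1).div ((hasDerivAt_id x).const_sub 1) ha).log
    (div_ne_zero hb ha)).div_const 2
  refine (h.congr_deriv ?_)
  have hc : 1 - x ^ 2 ≠ 0 := by
    have : 1 - x ^ 2 = (1 - x) * (1 + x) := by ring
    rw [this]; exact mul_ne_zero ha hb
  simp only [id, Pi.div_apply]
  field_simp
  ring

lemma arctanh_sub_aux {s u : ℝ} (hs0 : -1 < s) (hs1 : s < 1) (hu0 : -1 < u) (hu1 : u < 1) :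
    arctanh ((s - u) / (1 - s * u)) = arctanh s - arctanh u := by
  have h1 : 0 < 1 - s := by linarith
  have h2 : 0 < 1 + s := by linarith
  have h3 : 0 < 1 - u := by linarith
  have h4 : 0 < 1 + u := by linarith
  have h5 : 0 < 1 - s * u := by nlinarith [mul_pos h1 h4, mul_pos h2 h3]
  have e1 : 1 + (s - u) / (1 - s * u) = (1 + s) * (1 - u) / (1 - s * u) := by
    field_simp; ring
  have e2 : 1 - (s - u) / (1 - s * u) = (1 - s) * (1 + u) / (1 - s * u) := by
    field_simp; ring
  unfold arctanh
  rw [e1, e2, div_div_div_cancel_right₀ h5.ne', Real.log_div (by positivity) (by positivity),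
    Real.log_mul h2.ne' h3.ne', Real.log_mul h1.ne' h4.ne', Real.log_div h2.ne' h1.ne',
    Real.log_div h4.ne' h3.ne']
  ring

lemma corridor_aux {k t σ : ℝ} (hk0 : 0 < k) (hk1 : k < 1) (h0 : 0 ≤ t) (hk : t ≤ k)
    (h : corridor k t σ) : 0 ≤ v k t ∧ v k t < 1 ∧ v k t ≤ k * σ ∧ k * σ < 1 ∧
      |k * σ - k| ≤ t := by
  obtain ⟨hl, hr⟩ := h
  have hl := (le_max_left _ _).trans hl
  have hr := hr.trans (min_le_left _ _)
  have p1 : 0 < 1 - k * t := by nlinarith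
  have p2 : 0 < 1 + k * t := by positivity
  rw [div_le_iff₀ (by positivity)] at hl
  rw [le_div_iff₀ (by positivity)] at hr
  have a1 : v k t ≤ k * σ := by
    unfold v; rw [div_le_iff₀ p1]; linarith
  have a2 : k * σ ≤ (k + t) / (1 + k * t) := by
    rw [le_div_iff₀ p2]; linarith
  refine ⟨div_nonneg (by linarith) p1.le, ?_, a1, ?_, ?_⟩
  · unfold v; rw [div_lt_one p1]; nlinarith
  · apply a2.trans_lt; rw [div_lt_one p2]; nlinarith
  · have b2 : (k + t) / (1 + k * t) ≤ k + t := by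
      rw [div_le_iff₀ p2]; nlinarith [mul_nonneg hk0.le h0, add_nonneg hk0.le h0]
    have b1 : k - t ≤ v k t := by
      unfold v; rw [le_div_iff₀ p1]
      nlinarith [mul_nonneg (mul_nonneg hk0.le h0) (sub_nonneg.2 hk)]
    rw [abs_le]; constructor <;> linarith

/-- If `σ` satisfies the corridor condition (5.6) on `[0,k]`, then `0 ≤ K(t) < 1` on
`[0,k]` and `artanh (K(t)) = k(σ(t)-1)/(1-k²) + t + o(t)` as `t → 0⁺`. -/
theorem arctanh_K_asymptotic (k : ℝ) (hk0 : 0 < k) (hk1 : k < 1) (σ : ℝ → ℝ)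
    (hσ : ∀ t ∈ Set.Icc (0:ℝ) k, corridor k t (σ t)) :
    (∀ t ∈ Set.Icc (0:ℝ) k, 0 ≤ Kdil k σ t ∧ Kdil k σ t < 1) ∧
    Tendsto
      (fun t => (arctanh (Kdil k σ t) - k * (σ t - 1) / (1 - k ^ 2) - t) / t)
      (𝓝[>] (0:ℝ)) (𝓝 0) := by
  constructor
  · intro t ht
    obtain ⟨h1, h2, h3, h4, -⟩ := corridor_aux hk0 hk1 ht.1 ht.2 (hσ t ht)
    have h5 : 0 < 1 - k * σ t * v k t := by nlinarith
    unfold Kdil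
    refine ⟨div_nonneg (by linarith) h5.le, ?_⟩
    rw [div_lt_one h5]
    nlinarith [mul_pos (sub_pos.2 h4) (by linarith : 0 < 1 + v k t)]
  · have hev : ∀ᶠ t in 𝓝[>] (0:ℝ), t ∈ Set.Ioc (0:ℝ) k := Ioc_mem_nhdsGT hk0
    have hO : (fun t => k * σ t - k) =O[𝓝[>] (0:ℝ)] (fun t => t) := by
      apply Asymptotics.IsBigO.of_bound 1
      filter_upwards [hev] with t ht
      have := (corridor_aux hk0 hk1 ht.1.le ht.2 (hσ t ⟨ht.1.le, ht.2⟩)).2.2.2.2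
      rw [Real.norm_eq_abs, Real.norm_eq_abs, abs_of_pos ht.1]; linarith
    have hid : Tendsto (fun t : ℝ => t) (𝓝[>] (0:ℝ)) (𝓝 0) :=
      tendsto_id.mono_left nhdsWithin_le_nhds
    have hs : Tendsto (fun t => k * σ t) (𝓝[>] (0:ℝ)) (𝓝 k) := by
      have := (hO.trans_tendsto hid).add_const k
      simpa using this
    have d1 := ((hasDerivAt_iff_isLittleO.1
      (hasDerivAt_arctanh_aux (by linarith : -1 < k) hk1)).comp_tendsto hs).trans_isBigO hO
    have d2 := (hasDerivAt_iff_isLittleO.1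
      (hasDerivAt_arctanh_aux (by norm_num : (-1:ℝ) < 0) one_pos)).comp_tendsto hid
    simp only [Function.comp_def, sub_zero] at d1 d2
    refine ((d1.add d2).tendsto_div_nhds_zero).congr' ?_
    filter_upwards [hev] with t ht
    obtain ⟨h1, h2, h3, h4, -⟩ := corridor_aux hk0 hk1 ht.1.le ht.2 (hσ t ⟨ht.1.le, ht.2⟩)
    have e1 : arctanh (Kdil k σ t) = arctanh (k * σ t) - arctanh (v k t) :=
      arctanh_sub_aux (by linarith) h4 (by linarith) h2
    have e2 : arctanh (v k t) = arctanh k - arctanh t :=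
      arctanh_sub_aux (by linarith) hk1 (by linarith [ht.1]) (by linarith [ht.2])
    have e3 : arctanh 0 = 0 := by simp [arctanh]
    rw [e1, e2, e3]
    simp only [smul_eq_mul]
    ring
end

section
/- Let $0 < k < 1$ and let $\sigma : [0,k] \to \mathbb{R}$ satisfy, for every $t \in [0,k]$, $\max\{(k-t)/(k(1-kt)),\; t/k\} \le \sigma(t) \le \min\{(k+t)/(k(1+kt)),\; (2k-(1+k^2)t)/(k(1+k^2-2kt))\}$. Set $v(t) = (k-t)/(1-kt)$ and $K(t) = (k\sigma(t) - v(t))/(1 - k\sigma(t)\,v(t))$. Then the limit $\lim_{t\to 0^+} \operatorname{artanh}(K(t))/t$ exists (as a real number) if and only if the right derivative $\delta = \lim_{t\to 0^+} (\sigma(t)-1)/t$ exists; and in that case $\lim_{t\to 0^+} \operatorname{artanh}(K(t))/t = 1 + k\delta/(1-k^2)$, a number lying in $[0,2]$. -/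
open Filter Topology

lemma arctanh_hasDerivAt_zero : HasDerivAt arctanh 1 0 := by
  have h1 : HasDerivAt (fun x : ℝ => (1 + x) / (1 - x)) 2 0 := by
    have a : HasDerivAt (fun x : ℝ => 1 + x) 1 0 := (hasDerivAt_id (0:ℝ)).const_add 1
    have b : HasDerivAt (fun x : ℝ => 1 - x) (-1) 0 := (hasDerivAt_id (0:ℝ)).const_sub 1
    have := a.fun_div b (by norm_num)
    exact this.congr_deriv (by norm_num)
  have h2 := (h1.log (by norm_num)).div_const 2
  have h3 : HasDerivAt (fun x : ℝ => Real.log ((1 + x) / (1 - x)) / 2) 1 0 := by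
    exact h2.congr_deriv (by norm_num)
  exact h3

/-- The limit `lim_{t→0⁺} artanh(K(t))/t` exists iff the right derivative
`δ = lim_{t→0⁺} (σ(t)-1)/t` exists, in which case the former limit equals
`1 + kδ/(1-k²)`, a number in `[0,2]`. -/
theorem angle_exists_iff (k : ℝ) (hk0 : 0 < k) (hk1 : k < 1) (σ : ℝ → ℝ)
    (hσ : ∀ t ∈ Set.Icc (0:ℝ) k, corridor k t (σ t)) :
    ((∃ L : ℝ, Tendsto (fun t => arctanh (Kdil k σ t) / t) (𝓝[>] (0:ℝ)) (𝓝 L)) ↔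
      (∃ δ : ℝ, Tendsto (fun t => (σ t - 1) / t) (𝓝[>] (0:ℝ)) (𝓝 δ))) ∧
    (∀ δ : ℝ, Tendsto (fun t => (σ t - 1) / t) (𝓝[>] (0:ℝ)) (𝓝 δ) →
      Tendsto (fun t => arctanh (Kdil k σ t) / t) (𝓝[>] (0:ℝ))
        (𝓝 (1 + k * δ / (1 - k ^ 2))) ∧
      1 + k * δ / (1 - k ^ 2) ∈ Set.Icc (0:ℝ) 2) := by
  have hk2 : 0 < 1 - k ^ 2 := by nlinarith
  have hid : Tendsto (fun t : ℝ => t) (𝓝[>] (0:ℝ)) (𝓝 0) := tendsto_nhdsWithin_of_tendsto_nhds tendsto_id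
  have hev : ∀ᶠ t in 𝓝[>] (0:ℝ), 0 < t ∧ t < k := Ioo_mem_nhdsGT hk0
  have hlo : Tendsto (fun t : ℝ => -((1 - k ^ 2) / (k * (1 - k * t)))) (𝓝[>] (0:ℝ))
      (𝓝 (-((1 - k ^ 2) / k))) := by
    have : ContinuousAt (fun t : ℝ => -((1 - k ^ 2) / (k * (1 - k * t)))) 0 := by
      refine ContinuousAt.neg (ContinuousAt.div (by fun_prop) (by fun_prop) (by simp [hk0.ne']))
    have h := this.tendsto.mono_left (nhdsWithin_le_nhds (s := Set.Ioi (0:ℝ)))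
    simpa using h
  have hhi : Tendsto (fun t : ℝ => ((1 - k ^ 2) / (k * (1 + k * t)))) (𝓝[>] (0:ℝ))
      (𝓝 (((1 - k ^ 2) / k))) := by
    have : ContinuousAt (fun t : ℝ => ((1 - k ^ 2) / (k * (1 + k * t)))) 0 := by
      refine (ContinuousAt.div (by fun_prop) (by fun_prop) (by simp [hk0.ne']))
    have h := this.tendsto.mono_left (nhdsWithin_le_nhds (s := Set.Ioi (0:ℝ)))
    simpa using h
  have hb : ∀ᶠ t in 𝓝[>] (0:ℝ), -((1 - k ^ 2) / (k * (1 - k * t))) ≤ (σ t - 1) / t ∧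
      (σ t - 1) / t ≤ (1 - k ^ 2) / (k * (1 + k * t)) := by
    filter_upwards [hev] with t ht
    obtain ⟨h0, h1⟩ := ht
    have hc := hσ t ⟨h0.le, h1.le⟩
    have hl := (le_max_left _ _).trans hc.1
    have hu := hc.2.trans (min_le_left _ _)
    have p1 : 0 < 1 - k * t := by nlinarith
    have p2 : 0 < 1 + k * t := by positivity
    constructor
    · rw [le_div_iff₀ h0]
      have : -((1 - k ^ 2) / (k * (1 - k * t))) * t = (k - t) / (k * (1 - k * t)) - 1 := by
        have := p1.ne'
        field_simp
        ring
      linarith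
    · rw [div_le_iff₀ h0]
      have : ((1 - k ^ 2) / (k * (1 + k * t))) * t = (k + t) / (k * (1 + k * t)) - 1 := by
        have := p2.ne'
        field_simp
        ring
      linarith
  have hs1 : Tendsto σ (𝓝[>] (0:ℝ)) (𝓝 1) := by
    have a := (hlo.mul hid).const_add 1
    have b := (hhi.mul hid).const_add 1
    rw [mul_zero, add_zero] at a b
    refine tendsto_of_tendsto_of_tendsto_of_le_of_le' a b ?_ ?_
    · filter_upwards [hev, hb] with t ht hbt
      have := (le_div_iff₀ ht.1).1 hbt.1
      linarith
    · filter_upwards [hev, hb] with t ht hbt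
      have := (div_le_iff₀ ht.1).1 hbt.2
      linarith
  have hv : Tendsto (fun t => v k t) (𝓝[>] (0:ℝ)) (𝓝 k) := by
    have : ContinuousAt (fun t : ℝ => (k - t) / (1 - k * t)) 0 := by
      refine (ContinuousAt.div (by fun_prop) (by fun_prop) (by simp))
    have h := this.tendsto.mono_left (nhdsWithin_le_nhds (s := Set.Ioi (0:ℝ)))
    simpa [v] using h
  have hD : Tendsto (fun t => 1 - k * σ t * v k t) (𝓝[>] (0:ℝ)) (𝓝 (1 - k ^ 2)) := by
    have := ((hs1.const_mul k).mul hv).const_sub 1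
    convert this using 2
    ring
  have hK : Tendsto (fun t => Kdil k σ t) (𝓝[>] (0:ℝ)) (𝓝 0) := by
    have := ((hs1.const_mul k).sub hv).div hD hk2.ne'
    rw [mul_one, sub_self, zero_div] at this
    exact this
  have hg : Tendsto (fun t => dslope arctanh 0 (Kdil k σ t)) (𝓝[>] (0:ℝ)) (𝓝 1) := by
    have hc : ContinuousAt (dslope arctanh 0) 0 :=
      continuousAt_dslope_same.2 arctanh_hasDerivAt_zero.differentiableAt
    have h := hc.tendsto.comp hK
    rw [dslope_same, arctanh_hasDerivAt_zero.deriv] at h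
    exact h
  have hG := hg.div hD hk2.ne'
  have hw : Tendsto (fun t : ℝ => (1 - k ^ 2) / (1 - k * t)) (𝓝[>] (0:ℝ)) (𝓝 (1 - k ^ 2)) := by
    have : ContinuousAt (fun t : ℝ => (1 - k ^ 2) / (1 - k * t)) 0 := by
      refine (ContinuousAt.div (by fun_prop) (by fun_prop) (by simp))
    have h := this.tendsto.mono_left (nhdsWithin_le_nhds (s := Set.Ioi (0:ℝ)))
    simpa using h
  have key : ∀ᶠ t in 𝓝[>] (0:ℝ), arctanh (Kdil k σ t) / t =
      (dslope arctanh 0 (Kdil k σ t) / (1 - k * σ t * v k t)) *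
        (k * ((σ t - 1) / t) + (1 - k ^ 2) / (1 - k * t)) := by
    filter_upwards [hev, hD.eventually_ne hk2.ne'] with t ht hDt
    obtain ⟨h0, h1⟩ := ht
    have p1 : 1 - k * t ≠ 0 := by
      have : 0 < 1 - k * t := by nlinarith
      exact this.ne'
    have e : arctanh (Kdil k σ t) = dslope arctanh 0 (Kdil k σ t) * Kdil k σ t := by
      have := sub_smul_dslope arctanh 0 (Kdil k σ t)
      have z : arctanh 0 = 0 := by simp [arctanh]
      rw [z, sub_zero, sub_zero, smul_eq_mul] at this
      rw [← this]
      ring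
    have e2 : k * σ t - v k t = (k * ((σ t - 1) / t) + (1 - k ^ 2) / (1 - k * t)) * t := by
      unfold v
      field_simp
      ring
    have e3 : Kdil k σ t = (k * ((σ t - 1) / t) + (1 - k ^ 2) / (1 - k * t)) * t
        / (1 - k * σ t * v k t) := by
      rw [← e2, Kdil]
    rw [e]
    generalize dslope arctanh 0 (Kdil k σ t) = G
    rw [e3]
    generalize (k * ((σ t - 1) / t) + (1 - k ^ 2) / (1 - k * t)) = A
    field_simp
  have fwd : ∀ δ : ℝ, Tendsto (fun t => (σ t - 1) / t) (𝓝[>] (0:ℝ)) (𝓝 δ) →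
      Tendsto (fun t => arctanh (Kdil k σ t) / t) (𝓝[>] (0:ℝ))
        (𝓝 (1 + k * δ / (1 - k ^ 2))) := by
    intro δ hδ
    have h := hG.mul ((hδ.const_mul k).add hw)
    have e : 1 + k * δ / (1 - k ^ 2) = 1 / (1 - k ^ 2) * (k * δ + (1 - k ^ 2)) := by
      have := hk2.ne'
      field_simp
      ring
    rw [e]
    exact h.congr' (key.mono fun t ht => ht.symm)
  refine ⟨⟨?_, fun ⟨δ, hδ⟩ => ⟨_, fwd δ hδ⟩⟩, fun δ hδ => ⟨fwd δ hδ, ?_⟩⟩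
  · rintro ⟨L, hL⟩
    have hne : (1:ℝ) / (1 - k ^ 2) ≠ 0 := by positivity
    refine ⟨_, (((hL.div hG hne).sub hw).div_const k).congr' ?_⟩
    filter_upwards [key, hG.eventually_ne hne] with t ht hGt
    simp only [Pi.div_apply] at hGt ⊢
    rw [ht, mul_div_cancel_left₀ _ hGt, add_sub_cancel_right, mul_div_cancel_left₀ _ hk0.ne']
  · have a := le_of_tendsto_of_tendsto hlo hδ (hb.mono fun t h => h.1)
    have b := le_of_tendsto_of_tendsto hδ hhi (hb.mono fun t h => h.2)
    rw [← neg_div, div_le_iff₀ hk0] at a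
    rw [le_div_iff₀ hk0] at b
    have a' : -1 ≤ k * δ / (1 - k ^ 2) := by rw [le_div_iff₀ hk2]; linarith
    have b' : k * δ / (1 - k ^ 2) ≤ 1 := by rw [div_le_iff₀ hk2]; linarith
    constructor <;> linarith
end

section
/- Let $0 < k < 1$. For every real number $\delta$ with $|\delta| \le (1-k^2)/k$, there exists a continuous function $\sigma : [0,k] \to \mathbb{R}$ such that: (a) for every $t \in [0,k]$, $\max\{(k-t)/(k(1-kt)),\; t/k\} \le \sigma(t) \le \min\{(k+t)/(k(1+kt)),\; (2k-(1+k^2)t)/(k(1+k^2-2kt))\}$; (b) there exists $\varepsilon > 0$ such that $\sigma(t) < (k+t)/(k(1+kt))$ for all $t \in (0,\varepsilon)$; and (c) $\lim_{t\to 0^+} (\sigma(t)-1)/t = \delta$. -/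
open Filter Topology

/-- For every `δ` with `|δ| ≤ (1-k²)/k` there is a continuous `σ` on `[0,k]` satisfying
the corridor condition (5.6), strictly below the first upper bound near `0` (condition
(5.12)), and with right derivative `δ` at `0`. -/
theorem exists_sigma_right_derivative (k δ : ℝ) (hk0 : 0 < k) (hk1 : k < 1)
    (hδ : |δ| ≤ (1 - k ^ 2) / k) :
    ∃ σ : ℝ → ℝ, ContinuousOn σ (Set.Icc 0 k) ∧
      (∀ t ∈ Set.Icc (0:ℝ) k, corridor k t (σ t)) ∧
      (∃ ε > 0, ∀ t ∈ Set.Ioo (0:ℝ) ε, σ t < (k + t) / (k * (1 + k * t))) ∧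
      Tendsto (fun t => (σ t - 1) / t) (𝓝[>] (0:ℝ)) (𝓝 δ) := by
  have hk2 : 0 < 1 - k ^ 2 := by nlinarith
  obtain ⟨a, ha⟩ : ∃ a, a = (1 - k ^ 2) / k := ⟨_, rfl⟩
  have ha0 : 0 < a := by rw [ha]; positivity
  rw [← ha] at hδ
  obtain ⟨hδ1, hδ2⟩ := abs_le.mp hδ
  obtain ⟨c, hc⟩ : ∃ c, c = (δ + a) / (2 * a) := ⟨_, rfl⟩
  have hc0 : 0 ≤ c := by rw [hc]; apply div_nonneg <;> linarith
  have hc1 : c ≤ 1 := by rw [hc, div_le_one (by linarith)]; linarith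
  have hca : -a + 2 * a * c = δ := by rw [hc]; field_simp; ring
  -- the four bounds
  obtain ⟨L1, hL1⟩ : ∃ f : ℝ → ℝ, f = fun t => (k - t) / (k * (1 - k * t)) := ⟨_, rfl⟩
  obtain ⟨U1, hU1⟩ : ∃ f : ℝ → ℝ, f = fun t => (k + t) / (k * (1 + k * t)) := ⟨_, rfl⟩
  obtain ⟨U2, hU2⟩ : ∃ f : ℝ → ℝ,
    f = fun t => (2 * k - (1 + k ^ 2) * t) / (k * (1 + k ^ 2 - 2 * k * t)) := ⟨_, rfl⟩
  have p1 : ∀ t ∈ Set.Icc (0:ℝ) k, 0 < 1 - k * t := by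
    rintro t ⟨h0, h1⟩; nlinarith
  have p2 : ∀ t ∈ Set.Icc (0:ℝ) k, 0 < 1 + k * t := by
    rintro t ⟨h0, h1⟩; nlinarith
  have p3 : ∀ t ∈ Set.Icc (0:ℝ) k, 0 < 1 + k ^ 2 - 2 * k * t := by
    rintro t ⟨h0, h1⟩; nlinarith
  have cL1 : ContinuousOn L1 (Set.Icc 0 k) := by
    rw [hL1]
    exact ContinuousOn.div (by fun_prop) (by fun_prop)
      (fun t ht => (mul_pos hk0 (p1 t ht)).ne')
  have cU1 : ContinuousOn U1 (Set.Icc 0 k) := by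
    rw [hU1]
    exact ContinuousOn.div (by fun_prop) (by fun_prop)
      (fun t ht => (mul_pos hk0 (p2 t ht)).ne')
  have cU2 : ContinuousOn U2 (Set.Icc 0 k) := by
    rw [hU2]
    exact ContinuousOn.div (by fun_prop) (by fun_prop)
      (fun t ht => (mul_pos hk0 (p3 t ht)).ne')
  have cL2 : ContinuousOn (fun t : ℝ => t / k) (Set.Icc 0 k) := by fun_prop
  have i11 : ∀ t ∈ Set.Icc (0:ℝ) k, 0 < t → L1 t < U1 t := by
    rintro t ht h0
    have := p1 t ht
    have := p2 t ht
    simp only [hL1, hU1]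
    rw [div_lt_div_iff₀ (by positivity) (by positivity)]
    have : 0 < k * (t * (1 - k ^ 2)) := by positivity
    nlinarith
  have i21 : ∀ t ∈ Set.Icc (0:ℝ) k, t / k < U1 t := by
    rintro t ht
    have := p2 t ht
    have h1 : t < 1 := ht.2.trans_lt hk1
    have h0 := ht.1
    simp only [hU1]
    rw [div_lt_div_iff₀ (by positivity) (by positivity)]
    have : 0 < k * k * (1 - t ^ 2) := mul_pos (by positivity) (by nlinarith)
    nlinarith
  have i12 : ∀ t ∈ Set.Icc (0:ℝ) k, L1 t ≤ U2 t := by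
    rintro t ht
    have := p1 t ht
    have := p3 t ht
    have h1 : t < 1 := ht.2.trans_lt hk1
    have h0 := ht.1
    simp only [hL1, hU2]
    rw [div_le_div_iff₀ (by positivity) (by positivity)]
    have h2 : 0 < 1 - t ^ 2 := by nlinarith
    have : 0 < k * (k * (1 - k ^ 2) * (1 - t ^ 2)) := by positivity
    nlinarith
  have i22 : ∀ t ∈ Set.Icc (0:ℝ) k, t / k ≤ U2 t := by
    rintro t ht
    have h1 := p1 t ht
    have := p3 t ht
    simp only [hU2]
    rw [div_le_div_iff₀ (by positivity) (by positivity)]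
    have : 0 ≤ k * (2 * (k - t) * (1 - k * t)) := by
      have : 0 ≤ k - t := by linarith [ht.2]
      positivity
    nlinarith
  have i0 : ∀ t ∈ Set.Icc (0:ℝ) k, max (L1 t) (t / k) ≤ min (U1 t) (U2 t) := by
    intro t ht
    refine max_le (le_min ?_ (i12 t ht)) (le_min (i21 t ht).le (i22 t ht))
    rcases ht.1.eq_or_lt with h | h
    · subst h; simp [hL1, hU1]
    · exact (i11 t ht h).le
  refine ⟨fun t => max (L1 t) (t / k) + c * (1 - t) *
    (min (U1 t) (U2 t) - max (L1 t) (t / k)), ?_, ?_, ?_, ?_⟩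
  · have hm : ContinuousOn (fun t => max (L1 t) (t / k)) (Set.Icc 0 k) := ContinuousOn.sup cL1 cL2
    have hM : ContinuousOn (fun t => min (U1 t) (U2 t)) (Set.Icc 0 k) := ContinuousOn.inf cU1 cU2
    exact hm.add (ContinuousOn.mul (by fun_prop) (hM.sub hm))
  · intro t ht
    have h := i0 t ht
    have h1 : 0 ≤ 1 - t := by linarith [ht.2]
    have h2 : 0 ≤ c * (1 - t) := by positivity
    have h3 : c * (1 - t) ≤ 1 := by nlinarith [ht.1]
    have e1 : (k - t) / (k * (1 - k * t)) = L1 t := by rw [hL1]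
    have e2 : (k + t) / (k * (1 + k * t)) = U1 t := by rw [hU1]
    have e3 : (2 * k - (1 + k ^ 2) * t) / (k * (1 + k ^ 2 - 2 * k * t)) = U2 t := by rw [hU2]
    unfold corridor
    rw [e1, e2, e3]
    constructor <;> nlinarith
  · refine ⟨k, hk0, fun t ht => ?_⟩
    have ht' : t ∈ Set.Icc (0:ℝ) k := ⟨ht.1.le, ht.2.le⟩
    have e2 : (k + t) / (k * (1 + k * t)) = U1 t := by rw [hU1]
    rw [e2]
    have h := max_lt (i11 t ht' ht.1) (i21 t ht')
    have hm := min_le_left (U1 t) (U2 t)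
    have h1 : 0 ≤ 1 - t := by linarith [ht.2]
    have h2 : 0 ≤ c * (1 - t) := by positivity
    have h3 : c * (1 - t) < 1 := by nlinarith [ht.1]
    show max (L1 t) (t / k) + c * (1 - t) *
      (min (U1 t) (U2 t) - max (L1 t) (t / k)) < U1 t
    nlinarith [mul_le_mul_of_nonneg_left hm h2]
  · have hg : Tendsto (fun t : ℝ => (1 - c * (1 - t)) * (-a / (1 - k * t)) +
        c * (1 - t) * (a / (1 + k * t))) (𝓝[>] (0:ℝ)) (𝓝 δ) := by
      have : ContinuousAt (fun t : ℝ => (1 - c * (1 - t)) * (-a / (1 - k * t)) +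
        c * (1 - t) * (a / (1 + k * t))) 0 := by
        have q1 : ContinuousAt (fun t : ℝ => -a / (1 - k * t)) 0 :=
          ContinuousAt.div (by fun_prop) (by fun_prop) (by simp)
        have q2 : ContinuousAt (fun t : ℝ => a / (1 + k * t)) 0 :=
          ContinuousAt.div (by fun_prop) (by fun_prop) (by simp)
        exact (ContinuousAt.mul (by fun_prop) q1).add (ContinuousAt.mul (by fun_prop) q2)
      have h := this.tendsto.mono_left (nhdsWithin_le_nhds (s := Set.Ioi 0))
      convert h using 2
      rw [← hca]; ring
    refine hg.congr' ?_
    filter_upwards [Ioo_mem_nhdsGT (show (0:ℝ) < k / 2 by linarith)] with t ht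
    have ht0 := ht.1
    have ht2 := ht.2
    have ht' : t ∈ Set.Icc (0:ℝ) k := ⟨ht.1.le, by linarith⟩
    have r1 := p1 t ht'
    have r2 := p2 t ht'
    have r3 := p3 t ht'
    have m1 : t / k ≤ L1 t := by
      simp only [hL1]
      rw [div_le_div_iff₀ (by positivity) (by positivity)]
      have : 0 ≤ k * (k - 2 * t + k * t ^ 2) :=
        mul_nonneg hk0.le (by nlinarith [mul_pos hk0 (pow_pos ht0 2)])
      nlinarith
    have m2 : U1 t ≤ U2 t := by
      simp only [hU1, hU2]
      rw [div_le_div_iff₀ (by positivity) (by positivity)]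
      have : 0 ≤ k * ((1 - k ^ 2) * (k - 2 * t + k * t ^ 2)) :=
        mul_nonneg hk0.le (mul_nonneg hk2.le (by nlinarith [mul_pos hk0 (pow_pos ht0 2)]))
      nlinarith
    rw [max_eq_left m1, min_eq_left m2]
    have s1 : -a / (1 - k * t) = (L1 t - 1) / t := by
      simp only [hL1, ha]
      field_simp
      ring
    have s2 : a / (1 + k * t) = (U1 t - 1) / t := by
      simp only [hU1, ha]
      field_simp
      ring
    rw [s1, s2]
    field_simp
    ring
end

section
/- Let $0 < k < 1$. For every real number $\eta$ with $|\eta| \le 1/k$, there exists a continuous function $\sigma : [0,k] \to \mathbb{R}$ such that: (a) for every $t \in [0,k]$, $\max\{(k-t)/(k(1-kt)),\; t/k\} \le \sigma(t) \le \min\{(k+t)/(k(1+kt)),\; (2k-(1+k^2)t)/(k(1+k^2-2kt))\}$; (b) there exists $\varepsilon > 0$ such that $\sigma(t) < (2k-(1+k^2)t)/(k(1+k^2-2kt))$ for all $t \in (k-\varepsilon, k)$; and (c) $\lim_{t\to k^-} (\sigma(t)-1)/(t-k) = \eta$. -/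
open Filter Topology

/-- For every `η` with `|η| ≤ 1/k` there is a continuous `σ` on `[0,k]` satisfying the
corridor condition (5.6), strictly below the second upper bound near `k` (condition
(5.13)), and with left derivative `η` at `k`. -/
theorem exists_sigma_left_derivative (k η : ℝ) (hk0 : 0 < k) (hk1 : k < 1)
    (hη : |η| ≤ 1 / k) :
    ∃ σ : ℝ → ℝ, ContinuousOn σ (Set.Icc 0 k) ∧
      (∀ t ∈ Set.Icc (0:ℝ) k, corridor k t (σ t)) ∧
      (∃ ε > 0, ∀ t ∈ Set.Ioo (k - ε) k,
        σ t < (2 * k - (1 + k ^ 2) * t) / (k * (1 + k ^ 2 - 2 * k * t))) ∧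
      Tendsto (fun t => (σ t - 1) / (t - k)) (𝓝[<] k) (𝓝 η) := by
  have hkk : 0 < 1 - k ^ 2 := by nlinarith
  obtain ⟨hη1, hη2⟩ := abs_le.mp hη
  have e1 : η * k ≤ 1 := by rwa [le_div_iff₀ hk0] at hη2
  have e2 : -1 ≤ η * k := by
    have := mul_le_mul_of_nonneg_right hη1 hk0.le
    have h2 : -(1 / k) * k = -1 := by field_simp
    linarith
  have d1 : ∀ t ∈ Set.Icc (0:ℝ) k, 0 < 1 - k * t := fun t ht => by nlinarith [ht.1, ht.2]
  have d2 : ∀ t ∈ Set.Icc (0:ℝ) k, 0 < 1 + k * t := fun t ht => by nlinarith [ht.1, ht.2]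
  have d3 : ∀ t ∈ Set.Icc (0:ℝ) k, 0 < 1 + k ^ 2 - 2 * k * t :=
    fun t ht => by nlinarith [ht.1, ht.2]
  let L1 : ℝ → ℝ := fun t => (k - t) / (k * (1 - k * t))
  let L2 : ℝ → ℝ := fun t => t / k
  let U1 : ℝ → ℝ := fun t => (k + t) / (k * (1 + k * t))
  let U2 : ℝ → ℝ := fun t => (2 * k - (1 + k ^ 2) * t) / (k * (1 + k ^ 2 - 2 * k * t))
  let lam : ℝ → ℝ := fun t => (1 - η * k) / 2 * (t / k)
  have b1 : ∀ t ∈ Set.Icc (0:ℝ) k, L1 t ≤ 1 := fun t ht => by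
    have := d1 t ht
    refine (div_le_one (by positivity)).mpr ?_
    nlinarith [ht.1, ht.2]
  have b2 : ∀ t ∈ Set.Icc (0:ℝ) k, L2 t ≤ 1 := fun t ht => (div_le_one hk0).mpr ht.2
  have b3 : ∀ t ∈ Set.Icc (0:ℝ) k, 1 ≤ U1 t := fun t ht => by
    have := d2 t ht
    refine (one_le_div (by positivity)).mpr ?_
    nlinarith [mul_nonneg ht.1 hkk.le]
  have b4 : ∀ t ∈ Set.Icc (0:ℝ) k, U2 t - 1 =
      (k - t) * ((1 - k ^ 2) / (k * (1 + k ^ 2 - 2 * k * t))) := fun t ht => by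
    have := (d3 t ht).ne'
    simp only [U2]
    rw [← mul_div_assoc, sub_eq_iff_eq_add, eq_comm, div_add_one (mul_ne_zero hk0.ne' this)]
    congr 1
    ring
  have b5 : ∀ t ∈ Set.Icc (0:ℝ) k, 1 ≤ U2 t := fun t ht => by
    have := d3 t ht
    have h := b4 t ht
    have : 0 ≤ (k - t) * ((1 - k ^ 2) / (k * (1 + k ^ 2 - 2 * k * t))) :=
      mul_nonneg (sub_nonneg.mpr ht.2) (by positivity)
    linarith
  have b6 : ∀ t ∈ Set.Ico (0:ℝ) k, 1 < U2 t := fun t ht => by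
    have ht' : t ∈ Set.Icc (0:ℝ) k := ⟨ht.1, ht.2.le⟩
    have := d3 t ht'
    have h := b4 t ht'
    have : 0 < (k - t) * ((1 - k ^ 2) / (k * (1 + k ^ 2 - 2 * k * t))) :=
      mul_pos (sub_pos.mpr ht.2) (by positivity)
    linarith
  have l0 : ∀ t ∈ Set.Icc (0:ℝ) k, 0 ≤ lam t := fun t ht =>
    mul_nonneg (by linarith) (div_nonneg ht.1 hk0.le)
  have l1 : ∀ t ∈ Set.Icc (0:ℝ) k, lam t ≤ t / k := fun t ht =>
    mul_le_of_le_one_left (div_nonneg ht.1 hk0.le) (by linarith)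
  have c1 : ContinuousOn L1 (Set.Icc 0 k) :=
    ContinuousOn.div (by fun_prop) (by fun_prop) fun t ht => (mul_pos hk0 (d1 t ht)).ne'
  have c2 : Continuous L2 := by simp only [L2]; fun_prop
  have c3 : ContinuousOn U1 (Set.Icc 0 k) :=
    ContinuousOn.div (by fun_prop) (by fun_prop) fun t ht => (mul_pos hk0 (d2 t ht)).ne'
  have c4 : ContinuousOn U2 (Set.Icc 0 k) :=
    ContinuousOn.div (by fun_prop) (by fun_prop) fun t ht => (mul_pos hk0 (d3 t ht)).ne'
  have c5 : Continuous lam := by simp only [lam]; fun_prop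
  have hkm : k ∈ Set.Icc (0:ℝ) k := ⟨hk0.le, le_rfl⟩
  refine ⟨fun t => (1 - lam t) * max (L1 t) (L2 t) + lam t * min (U1 t) (U2 t), ?_, ?_, ?_, ?_⟩
  · exact ((continuousOn_const.sub c5.continuousOn).mul (c1.sup c2.continuousOn)).add
      (c5.continuousOn.mul (c3.inf c4))
  · intro t ht
    have hL : max (L1 t) (L2 t) ≤ 1 := max_le (b1 t ht) (b2 t ht)
    have hU : 1 ≤ min (U1 t) (U2 t) := le_min (b3 t ht) (b5 t ht)
    have h0 := l0 t ht
    have h1 := (l1 t ht).trans (b2 t ht)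
    constructor
    · change max (L1 t) (L2 t) ≤ _
      nlinarith
    · change _ ≤ min (U1 t) (U2 t)
      nlinarith
  · refine ⟨k, hk0, fun t ht => ?_⟩
    rw [sub_self] at ht
    have ht' : t ∈ Set.Icc (0:ℝ) k := ⟨ht.1.le, ht.2.le⟩
    have hL : max (L1 t) (L2 t) ≤ 1 := max_le (b1 t ht') (b2 t ht')
    have hU : min (U1 t) (U2 t) ≤ U2 t := min_le_right _ _
    have h6 := b6 t ⟨ht.1.le, ht.2⟩
    have h0 := l0 t ht'
    have h1 : lam t < 1 := (l1 t ht').trans_lt ((div_lt_one hk0).mpr ht.2)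
    change (1 - lam t) * max (L1 t) (L2 t) + lam t * min (U1 t) (U2 t) < U2 t
    have a1 := mul_le_mul_of_nonneg_left hU h0
    have a2 := mul_lt_mul_of_pos_left (hL.trans_lt h6) (sub_pos.mpr h1)
    linarith
  · have hd := d3 k hkm
    have key : Tendsto (fun t => (1 - lam t) * (1 / k) +
        lam t * (-((1 - k ^ 2) / (k * (1 + k ^ 2 - 2 * k * t))))) (𝓝[<] k) (𝓝 η) := by
      have hc : ContinuousAt (fun t => (1 - lam t) * (1 / k) +
        lam t * (-((1 - k ^ 2) / (k * (1 + k ^ 2 - 2 * k * t))))) k := by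
        have : ContinuousAt (fun t => (1 - k ^ 2) / (k * (1 + k ^ 2 - 2 * k * t))) k :=
          ContinuousAt.div (by fun_prop) (by fun_prop) (mul_pos hk0 hd).ne'
        exact ((continuousAt_const.sub c5.continuousAt).mul continuousAt_const).add
          (c5.continuousAt.mul this.neg)
      have hv : (1 - lam k) * (1 / k) +
        lam k * (-((1 - k ^ 2) / (k * (1 + k ^ 2 - 2 * k * k)))) = η := by
        have h1 : 1 + k ^ 2 - 2 * k * k = 1 - k ^ 2 := by ring
        have h2 : lam k = (1 - η * k) / 2 := by
          simp only [lam]; rw [div_self hk0.ne', mul_one]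
        have h3 : (1 - k ^ 2) / (k * (1 - k ^ 2)) = 1 / k := by
          field_simp
        rw [h1, h2, h3]
        field_simp
        ring
      have := hc.tendsto
      rw [hv] at this
      exact this.mono_left nhdsWithin_le_nhds
    refine key.congr' ?_
    have n1 : ContinuousAt L1 k :=
      ContinuousAt.div (by fun_prop) (by fun_prop) (mul_pos hk0 (d1 k hkm)).ne'
    have n3 : ContinuousAt U1 k :=
      ContinuousAt.div (by fun_prop) (by fun_prop) (mul_pos hk0 (d2 k hkm)).ne'
    have n4 : ContinuousAt U2 k :=
      ContinuousAt.div (by fun_prop) (by fun_prop) (mul_pos hk0 hd).ne'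
    have v1 : L1 k < L2 k := by
      simp only [L1, L2]
      rw [sub_self, zero_div, div_self hk0.ne']
      exact one_pos
    have v2 : U2 k < U1 k := by
      have h := b4 k hkm
      rw [sub_self, zero_mul] at h
      have : 1 < U1 k := by
        refine (one_lt_div (mul_pos hk0 (d2 k hkm))).mpr ?_
        nlinarith
      linarith
    have ev1 := nhdsWithin_le_nhds (s := Set.Iio k) (n1.eventually_lt c2.continuousAt v1)
    have ev2 := nhdsWithin_le_nhds (s := Set.Iio k) (n4.eventually_lt n3 v2)
    filter_upwards [ev1, ev2, Ioo_mem_nhdsLT hk0] with t h1 h2 ht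
    have h1' : L1 t < L2 t := h1
    have h2' : U2 t < U1 t := h2
    rw [max_eq_right h1'.le, min_eq_right h2'.le]
    have h4 := b4 t ⟨ht.1.le, ht.2.le⟩
    have hne : t - k ≠ 0 := sub_ne_zero.mpr ht.2.ne
    have h5 : L2 t = 1 + (t - k) * (1 / k) := by
      simp only [L2]; field_simp; ring
    rw [eq_div_iff hne, h5, sub_eq_iff_eq_add.mp h4]
    ring
end

section
/- Let $0 < k < 1$ and define $\sigma : [0,\infty) \to \mathbb{R}$ by $\sigma(0) = 1$ and $\sigma(t) = 1 + \frac{1-k^2}{2k}\, t \sin^2(1/t)$ for $t > 0$. Then $\sigma$ is continuous at $0$; there exists $\varepsilon \in (0,k]$ such that for all $t \in (0,\varepsilon)$, $\max\{(k-t)/(k(1-kt)),\; t/k\} \le \sigma(t) < \min\{(k+t)/(k(1+kt)),\; (2k-(1+k^2)t)/(k(1+k^2-2kt))\}$; and the limit $\lim_{t\to 0^+} (\sigma(t)-1)/t$ does not exist (indeed $\liminf_{t\to 0^+} (\sigma(t)-1)/t = 0$ while $\limsup_{t\to 0^+} (\sigma(t)-1)/t = (1-k^2)/(2k)$). -/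
open Filter Topology

/-- The function `σ(t) = 1 + ((1-k²)/(2k)) t sin²(1/t)` for `t > 0`, `σ(0) = 1`. -/
noncomputable def sigmaOsc (k : ℝ) : ℝ → ℝ := fun t =>
  if t = 0 then 1 else 1 + (1 - k ^ 2) / (2 * k) * t * Real.sin (1 / t) ^ 2

theorem sigmaOsc_freq (k a v : ℝ) (ha : 0 ≤ a)
    (hv : ∀ n : ℕ, (1 - k ^ 2) / (2 * k) * Real.sin ((n + 1 : ℕ) * Real.pi + a) ^ 2 = v) :
    ∃ᶠ t in 𝓝[>] (0:ℝ), (sigmaOsc k t - 1) / t = v := by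
  have h1 : Tendsto (fun n : ℕ => ((n + 1 : ℕ) : ℝ) * Real.pi + a) atTop atTop := by
    apply tendsto_atTop_add_const_right
    apply Tendsto.atTop_mul_const Real.pi_pos
    exact tendsto_natCast_atTop_atTop.comp (tendsto_add_atTop_nat 1)
  have h2 := tendsto_inv_atTop_nhdsGT_zero.comp h1
  refine h2.frequently (Frequently.of_forall fun n => ?_)
  have hp : 0 < ((n + 1 : ℕ) : ℝ) * Real.pi + a := by
    have := Real.pi_pos
    positivity
  have hv := hv n
  simp only [Function.comp]
  generalize ((n + 1 : ℕ) : ℝ) * Real.pi + a = x at *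
  have hx : x⁻¹ ≠ 0 := by positivity
  simp only [sigmaOsc, if_neg hx, one_div, inv_inv]
  rw [← hv]
  generalize Real.sin x ^ 2 = s
  generalize (1 - k ^ 2) / (2 * k) = c
  field_simp
  ring

/-- The oscillating function `sigmaOsc k` is continuous at `0`, satisfies the corridor
condition (5.6) with strict upper inequalities on some interval `(0, ε)` with
`0 < ε ≤ k`, but its difference quotient at `0` has no limit from the right:
its liminf is `0` and its limsup is `(1-k²)/(2k)`. -/
theorem sigmaOsc_not_differentiable (k : ℝ) (hk0 : 0 < k) (hk1 : k < 1) :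
    ContinuousAt (sigmaOsc k) 0 ∧
    (∃ ε : ℝ, 0 < ε ∧ ε ≤ k ∧ ∀ t ∈ Set.Ioo (0:ℝ) ε,
      max ((k - t) / (k * (1 - k * t))) (t / k) ≤ sigmaOsc k t ∧
      sigmaOsc k t < min ((k + t) / (k * (1 + k * t)))
        ((2 * k - (1 + k ^ 2) * t) / (k * (1 + k ^ 2 - 2 * k * t)))) ∧
    (¬ ∃ L : ℝ, Tendsto (fun t => (sigmaOsc k t - 1) / t) (𝓝[>] (0:ℝ)) (𝓝 L)) ∧
    Filter.liminf (fun t => (sigmaOsc k t - 1) / t) (𝓝[>] (0:ℝ)) = 0 ∧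
    Filter.limsup (fun t => (sigmaOsc k t - 1) / t) (𝓝[>] (0:ℝ)) = (1 - k ^ 2) / (2 * k) := by
  have hc : 0 < (1 - k ^ 2) / (2 * k) := by
    apply div_pos <;> nlinarith
  have hq : ∀ᶠ t in 𝓝[>] (0:ℝ), 0 ≤ (sigmaOsc k t - 1) / t ∧
      (sigmaOsc k t - 1) / t ≤ (1 - k ^ 2) / (2 * k) := by
    filter_upwards [self_mem_nhdsWithin] with t ht
    have ht' : t ≠ 0 := ne_of_gt ht
    have he : (sigmaOsc k t - 1) / t = (1 - k ^ 2) / (2 * k) * Real.sin (1 / t) ^ 2 := by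
      simp only [sigmaOsc, if_neg ht']
      generalize Real.sin (1 / t) ^ 2 = s
      generalize (1 - k ^ 2) / (2 * k) = c
      field_simp
      ring
    rw [he]
    have := Real.sin_sq_le_one (1 / t)
    constructor
    · positivity
    · exact mul_le_of_le_one_right hc.le this
  have f0 : ∃ᶠ t in 𝓝[>] (0:ℝ), (sigmaOsc k t - 1) / t = 0 := by
    apply sigmaOsc_freq k 0 0 le_rfl
    intro n
    rw [add_zero, Real.sin_nat_mul_pi]
    simp
  have f1 : ∃ᶠ t in 𝓝[>] (0:ℝ), (sigmaOsc k t - 1) / t = (1 - k ^ 2) / (2 * k) := by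
    apply sigmaOsc_freq k (Real.pi / 2) _ (by have := Real.pi_pos; positivity)
    intro n
    rw [Real.sin_add_pi_div_two, Real.cos_nat_mul_pi, ← pow_mul, mul_comm (n + 1) 2, pow_mul]
    simp
  have hbl : IsBoundedUnder (· ≥ ·) (𝓝[>] (0:ℝ)) (fun t => (sigmaOsc k t - 1) / t) :=
    ⟨0, by simpa using hq.mono fun _ h => h.1⟩
  have hbu : IsBoundedUnder (· ≤ ·) (𝓝[>] (0:ℝ)) (fun t => (sigmaOsc k t - 1) / t) :=
    ⟨_, by simpa using hq.mono fun _ h => h.2⟩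
  have hli : Filter.liminf (fun t => (sigmaOsc k t - 1) / t) (𝓝[>] (0:ℝ)) = 0 := by
    apply le_antisymm
    · exact liminf_le_of_frequently_le (f0.mono fun _ h => h.le) hbl
    · exact le_liminf_of_le hbu.isCoboundedUnder_ge (hq.mono fun _ h => h.1)
  have hls : Filter.limsup (fun t => (sigmaOsc k t - 1) / t) (𝓝[>] (0:ℝ))
      = (1 - k ^ 2) / (2 * k) := by
    apply le_antisymm
    · exact limsup_le_of_le hbl.isCoboundedUnder_le (hq.mono fun _ h => h.2)
    · exact le_limsup_of_frequently_le (f1.mono fun _ h => h.ge) hbu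
  refine ⟨?_, ?_, ?_, hli, hls⟩
  · rw [ContinuousAt, show sigmaOsc k 0 = 1 by simp [sigmaOsc]]
    have hg : Tendsto (fun t : ℝ => (1 - k ^ 2) / (2 * k) * |t|) (𝓝 0) (𝓝 0) := by
      have : Continuous (fun t : ℝ => (1 - k ^ 2) / (2 * k) * |t|) := by fun_prop
      simpa using this.tendsto 0
    rw [tendsto_iff_dist_tendsto_zero]
    refine squeeze_zero (fun _ => dist_nonneg) (fun t => ?_) hg
    rw [Real.dist_eq]
    by_cases ht : t = 0
    · simp [sigmaOsc, ht]
    · simp only [sigmaOsc, if_neg ht, add_sub_cancel_left]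
      rw [abs_mul, abs_mul, abs_of_pos hc, abs_of_nonneg (sq_nonneg (Real.sin (1 / t)))]
      exact mul_le_of_le_one_right (by positivity) (Real.sin_sq_le_one _)
  · refine ⟨k / 2, by positivity, by linarith, ?_⟩
    rintro t ⟨ht0, ht⟩
    have hkk : 0 < 1 - k ^ 2 := by nlinarith
    have hkt : k * t < 1 := by nlinarith
    have hkt0 : 0 < k * t := by positivity
    have hlo : 1 ≤ sigmaOsc k t := by
      simp only [sigmaOsc, if_neg ht0.ne']
      have : 0 ≤ (1 - k ^ 2) / (2 * k) * t * Real.sin (1 / t) ^ 2 := by positivity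
      linarith
    have hhi : sigmaOsc k t ≤ (k + (1 - k ^ 2) * t / 2) / k := by
      simp only [sigmaOsc, if_neg ht0.ne']
      have : (1 - k ^ 2) / (2 * k) * t * Real.sin (1 / t) ^ 2 ≤ (1 - k ^ 2) / (2 * k) * t :=
        mul_le_of_le_one_right (by positivity) (Real.sin_sq_le_one _)
      have e : (k + (1 - k ^ 2) * t / 2) / k = 1 + (1 - k ^ 2) / (2 * k) * t := by
        field_simp
      linarith
    refine ⟨le_trans (max_le ?_ ?_) hlo, lt_of_le_of_lt hhi (lt_min ?_ ?_)⟩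
    · rw [div_le_one (mul_pos hk0 (by linarith))]
      nlinarith
    · rw [div_le_one hk0]
      linarith
    · rw [← div_div, div_right_comm]
      apply div_lt_div_of_pos_right _ hk0
      rw [lt_div_iff₀ (by linarith)]
      nlinarith [mul_pos (mul_pos hkk ht0) (sub_pos.2 hkt)]
    · have hd : 0 < 1 + k ^ 2 - 2 * k * t := by nlinarith
      rw [← div_div, div_right_comm]
      apply div_lt_div_of_pos_right _ hk0
      rw [lt_div_iff₀ hd]
      have h3 : 0 < k - t * ((3 + k ^ 2) / 2) + k * t ^ 2 := by
        have : 0 < t * (1 - k ^ 2) := by positivity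
        have : 0 < k * t ^ 2 := by positivity
        nlinarith
      nlinarith [mul_pos hkk h3]
  · rintro ⟨L, hL⟩
    have h1 := hL.liminf_eq
    have h2 := hL.limsup_eq
    rw [hli] at h1
    rw [hls] at h2
    linarith
end

section
/- Let $0 < k < 1$, let $s = \sqrt{1-k^2}$, and set $t_0 = k/(1+s)$ and $\sigma_0 = (2+s)/(1+k^2+s)$. Then: (a) $0 < t_0 < k$; (b) $(k-t_0)/(1-k t_0) = t_0$; (c) $\operatorname{artanh}(t_0) = \frac{1}{2}\operatorname{artanh}(k)$, i.e. $\frac{1}{2}\log\frac{1+t_0}{1-t_0} = \frac{1}{4}\log\frac{1+k}{1-k}$; (d) $\sigma_0 = (k+t_0)/(k(1+k t_0))$, so $\sigma_0$ satisfies the corridor condition (5.6) at $(k,t_0)$; and (e) $(k\sigma_0 - t_0)/(1 - k t_0 \sigma_0) = k$. -/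
/-- Remark 2 of Hu–Shen (equations (5.20)–(5.21)): with `s = √(1-k²)`,
`t₀ = k/(1+s)` and `σ₀ = (2+s)/(1+k²+s)`, one has `0 < t₀ < k`,
`(k-t₀)/(1-kt₀) = t₀`, `artanh t₀ = (artanh k)/2`, `σ₀` equals the first upper bound
of the corridor at `(k,t₀)` (hence satisfies the corridor condition), and
`(kσ₀ - t₀)/(1 - kt₀σ₀) = k`. -/
theorem midpoint_identities (k : ℝ) (hk0 : 0 < k) (hk1 : k < 1) :
    (0 < k / (1 + Real.sqrt (1 - k ^ 2)) ∧ k / (1 + Real.sqrt (1 - k ^ 2)) < k) ∧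
    (k - k / (1 + Real.sqrt (1 - k ^ 2))) / (1 - k * (k / (1 + Real.sqrt (1 - k ^ 2)))) =
      k / (1 + Real.sqrt (1 - k ^ 2)) ∧
    arctanh (k / (1 + Real.sqrt (1 - k ^ 2))) = arctanh k / 2 ∧
    ((2 + Real.sqrt (1 - k ^ 2)) / (1 + k ^ 2 + Real.sqrt (1 - k ^ 2)) =
        (k + k / (1 + Real.sqrt (1 - k ^ 2))) /
          (k * (1 + k * (k / (1 + Real.sqrt (1 - k ^ 2))))) ∧
      corridor k (k / (1 + Real.sqrt (1 - k ^ 2)))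
        ((2 + Real.sqrt (1 - k ^ 2)) / (1 + k ^ 2 + Real.sqrt (1 - k ^ 2)))) ∧
    (k * ((2 + Real.sqrt (1 - k ^ 2)) / (1 + k ^ 2 + Real.sqrt (1 - k ^ 2))) -
        k / (1 + Real.sqrt (1 - k ^ 2))) /
      (1 - k * (k / (1 + Real.sqrt (1 - k ^ 2))) *
        ((2 + Real.sqrt (1 - k ^ 2)) / (1 + k ^ 2 + Real.sqrt (1 - k ^ 2)))) = k := by
  obtain ⟨t, ht0, ht1, hk⟩ : ∃ t : ℝ, 0 < t ∧ t < 1 ∧ k = 2 * t / (1 + t ^ 2) := by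
    have h1 : 0 < 1 - k ^ 2 := by nlinarith
    have hs : 0 < Real.sqrt (1 - k ^ 2) := Real.sqrt_pos.mpr h1
    have hsq : Real.sqrt (1 - k ^ 2) ^ 2 = 1 - k ^ 2 := Real.sq_sqrt h1.le
    generalize Real.sqrt (1 - k ^ 2) = s at hs hsq
    refine ⟨k / (1 + s), by positivity, ?_, ?_⟩
    · rw [div_lt_one (by positivity)]; linarith
    · have : k ^ 2 = 1 - s ^ 2 := by linarith
      have h2 : 1 + (k / (1 + s)) ^ 2 = 2 / (1 + s) := by
        rw [div_pow, this]; field_simp; ring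
      rw [h2]; field_simp
  have hu : 0 < 1 - t ^ 2 := by nlinarith
  have hp : 0 < 1 + t ^ 2 := by positivity
  have hq : 0 < 1 + 3 * t ^ 2 := by positivity
  have hs : Real.sqrt (1 - k ^ 2) = (1 - t ^ 2) / (1 + t ^ 2) := by
    rw [Real.sqrt_eq_iff_mul_self_eq_of_pos (by positivity), hk]
    field_simp; ring
  have ht : k / (1 + Real.sqrt (1 - k ^ 2)) = t := by
    have : 1 + (1 - t ^ 2) / (1 + t ^ 2) = 2 / (1 + t ^ 2) := by field_simp; ring
    rw [hs, this, hk]; field_simp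
  have hσ : (2 + Real.sqrt (1 - k ^ 2)) / (1 + k ^ 2 + Real.sqrt (1 - k ^ 2)) =
      (3 + t ^ 2) * (1 + t ^ 2) / (2 * (1 + 3 * t ^ 2)) := by
    have h1 : 1 + k ^ 2 + (1 - t ^ 2) / (1 + t ^ 2) =
        2 * (1 + 3 * t ^ 2) / (1 + t ^ 2) ^ 2 := by rw [hk]; field_simp; ring
    have h2 : 2 + (1 - t ^ 2) / (1 + t ^ 2) = (3 + t ^ 2) / (1 + t ^ 2) := by field_simp; ring
    rw [hs, h1, h2]; field_simp
  rw [ht, hσ]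
  have e1 : k - t = t * (1 - t ^ 2) / (1 + t ^ 2) := by rw [hk]; field_simp; ring
  have e2 : 1 - k * t = (1 - t ^ 2) / (1 + t ^ 2) := by rw [hk]; field_simp; ring
  have e3 : k + t = t * (3 + t ^ 2) / (1 + t ^ 2) := by rw [hk]; field_simp; ring
  have e4 : 1 + k * t = (1 + 3 * t ^ 2) / (1 + t ^ 2) := by rw [hk]; field_simp; ring
  have e5 : 2 * k - (1 + k ^ 2) * t = t * (3 + t ^ 2) * (1 - t ^ 2) / (1 + t ^ 2) ^ 2 := by
    rw [hk]; field_simp; ring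
  have e6 : 1 + k ^ 2 - 2 * k * t = (1 + 3 * t ^ 2) * (1 - t ^ 2) / (1 + t ^ 2) ^ 2 := by
    rw [hk]; field_simp; ring
  have hd : (3 + t ^ 2) * (1 + t ^ 2) / (2 * (1 + 3 * t ^ 2)) =
      (k + t) / (k * (1 + k * t)) := by
    rw [e3, e4, hk]; field_simp
  have hd2 : (3 + t ^ 2) * (1 + t ^ 2) / (2 * (1 + 3 * t ^ 2)) =
      (2 * k - (1 + k ^ 2) * t) / (k * (1 + k ^ 2 - 2 * k * t)) := by
    rw [e5, e6, hk]; field_simp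
  have hl : t / k ≤ (3 + t ^ 2) * (1 + t ^ 2) / (2 * (1 + 3 * t ^ 2)) := by
    have : t / k = (1 + t ^ 2) / 2 := by rw [hk]; field_simp
    rw [this, div_le_div_iff₀ (by norm_num) (by positivity)]
    nlinarith [mul_pos hp hu]
  have hl2 : (k - t) / (k * (1 - k * t)) = t / k := by
    rw [e1, e2]; field_simp
  refine ⟨⟨ht0, ?_⟩, ?_, ?_, ⟨hd, max_le (hl2.trans_le hl) hl, le_min hd.le hd2.le⟩, ?_⟩
  · have : 0 < k - t := by rw [e1]; positivity
    linarith
  · rw [e1, e2]; field_simp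
  · unfold arctanh
    have hm : 0 < 1 - t := by linarith
    have e : (1 + k) / (1 - k) = ((1 + t) / (1 - t)) ^ 2 := by
      have a1 : 1 + k = (1 + t) ^ 2 / (1 + t ^ 2) := by rw [hk]; field_simp; ring
      have a2 : 1 - k = (1 - t) ^ 2 / (1 + t ^ 2) := by rw [hk]; field_simp; ring
      rw [a1, a2]; field_simp
    rw [e, Real.log_pow]; push_cast; ring
  · have b1 : k * ((3 + t ^ 2) * (1 + t ^ 2) / (2 * (1 + 3 * t ^ 2))) - t =
        2 * t * (1 - t ^ 2) / (1 + 3 * t ^ 2) := by rw [hk]; field_simp; ring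
    have b2 : 1 - k * t * ((3 + t ^ 2) * (1 + t ^ 2) / (2 * (1 + 3 * t ^ 2))) =
        (1 - t ^ 2) * (1 + t ^ 2) / (1 + 3 * t ^ 2) := by rw [hk]; field_simp; ring
    rw [b1, b2, hk]; field_simp
end
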